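/- Let (X,d) be a nontrivial compact metric space (i.e., X has at least two points) and let g ∈ D_m(I) be such that there exist z ∈ (0,1] and m ∈ ℕ with ξ_g(z) ≠ z and ξ_g^{m+1}(z) = ξ_g^m(z). Then for every continuous map f : X → X, the g-fuzzification f̃_g is not transitive on (F^1(X), d_∞). -/

import Mathlib

noncomputable section

open Set Metric

/-- The unit interval `I = [0,1]` as a subset of `ℝ`. -/
def I01 : Set ℝ := Set.Icc 0 1

/-- `g ∈ D_m(I)`: `g : I → I` is nondecreasing, right-continuous, `g 0 = 0`, `g 1 = 1`. -/
def Dm (g : ℝ → ℝ) : Prop :=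
  MonotoneOn g I01 ∧
  (∀ x ∈ I01, ContinuousWithinAt g (I01 ∩ Set.Ici x) x) ∧
  Set.MapsTo g I01 I01 ∧ g 0 = 0 ∧ g 1 = 1

/-- `ξ_g x = min g⁻¹([x,1])` (the min exists by right-continuity; `sInf` here). -/
def xiG (g : ℝ → ℝ) (x : ℝ) : ℝ := sInf {t | t ∈ I01 ∧ x ≤ g t}

/-- The `α`-cut `[A]_α` of a fuzzy set `A`. -/
def cut {X : Type*} (A : X → ℝ) (α : ℝ) : Set X := {x | α ≤ A x}

/-- The support of a fuzzy set. -/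
def supp {X : Type*} [TopologicalSpace X] (A : X → ℝ) : Set X := closure {x | 0 < A x}

/-- The `g`-cut `[A]_α^g = {x ∈ supp A : g (A x) ≥ α}`. -/
def gcut {X : Type*} [TopologicalSpace X] (g : ℝ → ℝ) (A : X → ℝ) (α : ℝ) : Set X :=
  {x | x ∈ supp A ∧ α ≤ g (A x)}

/-- `A ∈ F(X)`: an upper semicontinuous fuzzy set on `X`. -/
def IsFuzzy {X : Type*} [TopologicalSpace X] (A : X → ℝ) : Prop :=
  UpperSemicontinuous A ∧ ∀ x, A x ∈ I01

/-- `A ∈ F_0(X)`: a nonempty (not identically 0) upper semicontinuous fuzzy set. -/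
def InF0 {X : Type*} [TopologicalSpace X] (A : X → ℝ) : Prop := IsFuzzy A ∧ ∃ x, A x ≠ 0

/-- `A ∈ F^1(X)`: an upper semicontinuous fuzzy set attaining the value 1. -/
def InF1 {X : Type*} [TopologicalSpace X] (A : X → ℝ) : Prop := IsFuzzy A ∧ ∃ x, 1 ≤ A x

/-- The `g`-fuzzification `f̃_g(A)(x) = sup {g (A y) : y ∈ f⁻¹(x)}` (with `sup ∅ = 0`). -/
def fuzz {X : Type*} (f : X → X) (g : ℝ → ℝ) (A : X → ℝ) : X → ℝ :=
  fun x => sSup ((fun y => g (A y)) '' (f ⁻¹' {x}))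

open Classical in
/-- Hausdorff metric, extended by `d_H(∅,∅) = 0` and `d_H(∅,A) = diam X`. -/
def dH {X : Type*} [MetricSpace X] (A B : Set X) : ℝ :=
  if A = ∅ ∧ B = ∅ then 0
  else if A = ∅ ∨ B = ∅ then Metric.diam (Set.univ : Set X)
  else Metric.hausdorffDist A B

/-- The levelwise metric `d_∞(A,B) = sup {d_H([A]_α, [B]_α) : α ∈ (0,1]}`. -/
def dInfty {X : Type*} [MetricSpace X] (A B : X → ℝ) : ℝ :=
  sSup ((fun α => dH (cut A α) (cut B α)) '' Set.Ioc (0:ℝ) 1)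

/-- `K(X)`: the hyperspace of nonempty compact subsets of `X`. -/
def Kc (X : Type*) [MetricSpace X] : Set (Set X) := {A | IsCompact A ∧ A.Nonempty}

section Dyn

variable {Y : Type*}

/-- `U` is a (relatively) open subset of the space `(S, ρ)`. -/
def IsOpenIn (S : Set Y) (ρ : Y → Y → ℝ) (U : Set Y) : Prop :=
  U ⊆ S ∧ ∀ x ∈ U, ∃ ε > 0, ∀ y ∈ S, ρ x y < ε → y ∈ U

/-- Diameter of a set with respect to the distance function `ρ`. -/
def diamIn (ρ : Y → Y → ℝ) (U : Set Y) : ℝ := sSup (Set.image2 ρ U U)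

/-- Sensitive dependence on initial conditions of `T` on the space `(S, ρ)`. -/
def SensitiveOn (S : Set Y) (ρ : Y → Y → ℝ) (T : Y → Y) : Prop :=
  ∃ δ > 0, ∀ x ∈ S, ∀ ε > 0, ∃ y ∈ S, ρ x y < ε ∧ ∃ n : ℕ, δ < ρ (T^[n] x) (T^[n] y)

/-- `𝓕`-sensitivity of `T` on the space `(S, ρ)`. -/
def FSensitiveOn (S : Set Y) (ρ : Y → Y → ℝ) (T : Y → Y) (F : Set (Set ℕ)) : Prop :=
  ∃ ε > 0, ∀ U : Set Y, IsOpenIn S ρ U → U.Nonempty →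
    {n : ℕ | ε < diamIn ρ (T^[n] '' U)} ∈ F

/-- Multi-sensitivity of `T` on the space `(S, ρ)`. -/
def MultiSensitiveOn (S : Set Y) (ρ : Y → Y → ℝ) (T : Y → Y) : Prop :=
  ∃ ε > 0, ∀ (k : ℕ) (U : Fin k → Set Y),
    (∀ i, IsOpenIn S ρ (U i) ∧ (U i).Nonempty) →
    ∃ n : ℕ, ∀ i, ε < diamIn ρ (T^[n] '' U i)

/-- Topological transitivity of `T` on the space `(S, ρ)`. -/
def TransitiveOn (S : Set Y) (ρ : Y → Y → ℝ) (T : Y → Y) : Prop :=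
  ∀ U V : Set Y, IsOpenIn S ρ U → U.Nonempty → IsOpenIn S ρ V → V.Nonempty →
    ∃ n : ℕ, ((T^[n] '' U) ∩ V).Nonempty

/-- Weak mixing: `T × T` is transitive on `(S × S, max-metric)`. -/
def WeaklyMixingOn (S : Set Y) (ρ : Y → Y → ℝ) (T : Y → Y) : Prop :=
  TransitiveOn (S ×ˢ S) (fun p q => max (ρ p.1 q.1) (ρ p.2 q.2)) (Prod.map T T)

end Dyn

/-- A (proper) Furstenberg family on `ℤ⁺ = ℕ`. -/
def FurstenbergFamily (F : Set (Set ℕ)) : Prop :=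
  (∀ F1 F2 : Set ℕ, F1 ∈ F → F1 ⊆ F2 → F2 ∈ F) ∧ Set.univ ∈ F ∧ ∅ ∉ F

lemma xiG_le_iff {g : ℝ → ℝ} (hg : Dm g) {α t : ℝ} (hα : α ≤ 1) (ht : t ∈ I01) :
    xiG g α ≤ t ↔ α ≤ g t := by
  obtain ⟨hmono, hcont, -, -, hg1⟩ := hg
  have hbdd : BddBelow {t | t ∈ I01 ∧ α ≤ g t} := ⟨0, fun t ht => ht.1.1⟩
  have hmem1 : (1 : ℝ) ∈ {t | t ∈ I01 ∧ α ≤ g t} :=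
    ⟨⟨zero_le_one, le_rfl⟩, hα.trans_eq hg1.symm⟩
  refine ⟨fun h => ?_, fun h => csInf_le hbdd ⟨ht, h⟩⟩
  have hξ : xiG g α ∈ I01 :=
    ⟨le_csInf ⟨1, hmem1⟩ fun t ht => ht.1.1, csInf_le hbdd hmem1⟩
  refine le_trans ?_ (hmono hξ ht h)
  by_contra! hlt
  have hev := (hcont _ hξ).eventually_lt_const hlt
  obtain ⟨δ, hδ, hball⟩ := Metric.mem_nhdsWithin_iff.1 hev
  obtain ⟨u, hu, huδ⟩ := exists_lt_of_csInf_lt (⟨1, hmem1⟩ : Set.Nonempty _)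
    (lt_add_of_pos_right (xiG g α) hδ)
  have hξu : xiG g α ≤ u := csInf_le hbdd hu
  have hdist : u ∈ ball (xiG g α) δ := by
    rw [mem_ball, Real.dist_eq, abs_lt]
    constructor <;> linarith
  exact absurd (hball ⟨hdist, hu.1, hξu⟩) (not_lt.2 hu.2)

lemma xiG_mem_Ioc {g : ℝ → ℝ} (hg : Dm g) {α : ℝ} (hα : α ∈ Ioc (0 : ℝ) 1) :
    xiG g α ∈ Ioc (0 : ℝ) 1 := by
  constructor
  · by_contra! h
    have h0 := (xiG_le_iff hg hα.2 ⟨le_rfl, zero_le_one⟩).1 h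
    rw [hg.2.2.2.1] at h0
    exact absurd hα.1 (not_lt.2 h0)
  · exact (xiG_le_iff hg hα.2 ⟨zero_le_one, le_rfl⟩).2 (hα.2.trans_eq hg.2.2.2.2.symm)

lemma xiG_iterate_mem_Ioc {g : ℝ → ℝ} (hg : Dm g) {α : ℝ} (hα : α ∈ Ioc (0 : ℝ) 1) (n : ℕ) :
    (xiG g)^[n] α ∈ Ioc (0 : ℝ) 1 :=
  MapsTo.iterate (fun _ => xiG_mem_Ioc hg) n hα

section Fuzzification

variable {X : Type*} [MetricSpace X] [CompactSpace X] {f : X → X} {g : ℝ → ℝ} {A : X → ℝ}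

lemma exists_isGreatest_fiber (hf : Continuous f) (hg : Dm g) (hA : IsFuzzy A) {x : X}
    (hx : (f ⁻¹' {x}).Nonempty) :
    ∃ y, f y = x ∧ IsGreatest ((fun y => g (A y)) '' (f ⁻¹' {x})) (g (A y)) := by
  have hcpt : IsCompact (f ⁻¹' {x}) := (isClosed_singleton.preimage hf).isCompact
  obtain ⟨y, hy, hmax⟩ := (hA.1.upperSemicontinuousOn _).exists_isMaxOn hx hcpt
  refine ⟨y, hy, mem_image_of_mem _ hy, ?_⟩
  rintro _ ⟨u, hu, rfl⟩
  exact hg.1 (hA.2 u) (hA.2 y) (hmax hu)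

lemma fuzz_mem_I01 (hf : Continuous f) (hg : Dm g) (hA : IsFuzzy A) (x : X) :
    fuzz f g A x ∈ I01 := by
  rcases (f ⁻¹' {x}).eq_empty_or_nonempty with hx | hx
  · simp [fuzz, hx, I01]
  · obtain ⟨y, -, hy⟩ := exists_isGreatest_fiber hf hg hA hx
    rw [fuzz, hy.csSup_eq]
    exact hg.2.2.1 (hA.2 y)

lemma cut_fuzz (hf : Continuous f) (hg : Dm g) (hA : IsFuzzy A) {α : ℝ}
    (hα : α ∈ Ioc (0 : ℝ) 1) : cut (fuzz f g A) α = f '' cut A (xiG g α) := by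
  ext x
  rcases (f ⁻¹' {x}).eq_empty_or_nonempty with hx | hx
  · refine iff_of_false ?_ ?_
    · simp [cut, fuzz, hx, hα.1]
    · rintro ⟨y, -, hy⟩
      exact hx.subset (show y ∈ f ⁻¹' {x} from hy)
  · obtain ⟨y, hyx, hy⟩ := exists_isGreatest_fiber hf hg hA hx
    rw [cut, mem_ofPred_eq, fuzz, hy.csSup_eq]
    constructor
    · exact fun h => ⟨y, (xiG_le_iff hg hα.2 (hA.2 y)).2 h, hyx⟩
    · rintro ⟨u, hu, hux⟩
      exact ((xiG_le_iff hg hα.2 (hA.2 u)).1 hu).trans (hy.2 ⟨u, hux, rfl⟩)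

lemma IsFuzzy.fuzz (hf : Continuous f) (hg : Dm g) (hA : IsFuzzy A) :
    IsFuzzy (fuzz f g A) := by
  refine ⟨upperSemicontinuous_iff_isClosed_preimage.2 fun α => ?_, fuzz_mem_I01 hf hg hA⟩
  change IsClosed (cut (_root_.fuzz f g A) α)
  rcases le_or_gt α 0 with h0 | h0
  · convert isClosed_univ
    exact eq_univ_of_forall fun x => h0.trans (fuzz_mem_I01 hf hg hA x).1
  rcases lt_or_ge 1 α with h1 | h1
  · convert isClosed_empty
    exact eq_empty_of_forall_notMem fun x hx =>
      absurd (h1.trans_le hx) (not_lt.2 (fuzz_mem_I01 hf hg hA x).2)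
  rw [cut_fuzz hf hg hA ⟨h0, h1⟩]
  exact ((hA.1.isClosed_preimage _).isCompact.image hf).isClosed

lemma cut_iterate_fuzz (hf : Continuous f) (hg : Dm g) (n : ℕ) (hA : IsFuzzy A) {α : ℝ}
    (hα : α ∈ Ioc (0 : ℝ) 1) :
    cut ((_root_.fuzz f g)^[n] A) α = f^[n] '' cut A ((xiG g)^[n] α) := by
  induction n generalizing A with
  | zero => simp
  | succ n ih =>
    rw [Function.iterate_succ_apply, ih (hA.fuzz hf hg),
      cut_fuzz hf hg hA (xiG_iterate_mem_Ioc hg hα n), ← image_comp,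
      ← Function.iterate_succ, ← Function.iterate_succ_apply' (xiG g)]

end Fuzzification

section LevelwiseMetric

variable {X : Type*} [MetricSpace X]

lemma cut_nonempty {A : X → ℝ} (hA : InF1 A) {α : ℝ} (hα : α ≤ 1) : (cut A α).Nonempty :=
  hA.2.imp fun _ => hα.trans

lemma hausdorffDist_cut_lt [CompactSpace X] {A B : X → ℝ} (hA : InF1 A) (hB : InF1 B) {s : ℝ}
    (hs : dInfty A B < s) {α : ℝ} (hα : α ∈ Ioc (0 : ℝ) 1) :
    hausdorffDist (cut A α) (cut B α) < s := by
  have hdH : ∀ β ∈ Ioc (0 : ℝ) 1,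
      dH (cut A β) (cut B β) = hausdorffDist (cut A β) (cut B β) := fun β hβ => by
    simp [dH, (cut_nonempty hA hβ.2).ne_empty, (cut_nonempty hB hβ.2).ne_empty]
  have hb : ∀ S : Set X, Bornology.IsBounded S := fun S => isBounded_of_compactSpace
  rw [← hdH α hα]
  refine (le_csSup ⟨diam (univ : Set X), ?_⟩ (mem_image_of_mem _ hα)).trans_lt hs
  rintro _ ⟨β, hβ, rfl⟩
  change dH (cut A β) (cut B β) ≤ _
  rw [hdH β hβ]
  exact (hausdorffDist_le_diam (cut_nonempty hA hβ.2) (hb _) (cut_nonempty hB hβ.2) (hb _)).trans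
    (diam_mono (subset_univ _) (hb _))

lemma exists_mem_cut_dist_lt [CompactSpace X] {A B : X → ℝ} (hA : InF1 A) (hB : InF1 B) {s : ℝ}
    (hs : dInfty A B < s) {α : ℝ} (hα : α ∈ Ioc (0 : ℝ) 1) {x : X} (hx : x ∈ cut A α) :
    ∃ y ∈ cut B α, dist x y < s :=
  exists_dist_lt_of_hausdorffDist_lt hx (hausdorffDist_cut_lt hA hB hs hα)
    (hausdorffEDist_ne_top_of_nonempty_of_bounded (cut_nonempty hA hα.2) (cut_nonempty hB hα.2)
      isBounded_of_compactSpace isBounded_of_compactSpace)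

lemma exists_mem_cut_dist_lt' [CompactSpace X] {A B : X → ℝ} (hA : InF1 A) (hB : InF1 B) {s : ℝ}
    (hs : dInfty A B < s) {α : ℝ} (hα : α ∈ Ioc (0 : ℝ) 1) {y : X} (hy : y ∈ cut B α) :
    ∃ x ∈ cut A α, dist x y < s :=
  exists_dist_lt_of_hausdorffDist_lt' hy (hausdorffDist_cut_lt hA hB hs hα)
    (hausdorffEDist_ne_top_of_nonempty_of_bounded (cut_nonempty hA hα.2) (cut_nonempty hB hα.2)
      isBounded_of_compactSpace isBounded_of_compactSpace)

/-- The normal fuzzy sets whose positive levels all lie well inside the ball of radius `ε`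
around `a`. -/
def concentrated (a : X) (ε : ℝ) : Set (X → ℝ) :=
  {C | InF1 C ∧ ∃ r < ε, ∀ x, 0 < C x → dist x a ≤ r}

/-- The normal fuzzy sets whose `lo`-cut comes within `δ` of `b`, while their `hi`-cut stays
within `δ` of `a`. -/
def separated (a b : X) (lo hi δ : ℝ) : Set (X → ℝ) :=
  {C | InF1 C ∧ ∃ r < δ, (∃ q ∈ cut C lo, dist q b ≤ r) ∧ ∀ x ∈ cut C hi, dist x a ≤ r}

lemma isOpenIn_concentrated [CompactSpace X] (a : X) (ε : ℝ) :
    IsOpenIn {A : X → ℝ | InF1 A} dInfty (concentrated a ε) := by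
  refine ⟨fun C hC => hC.1, ?_⟩
  rintro C ⟨hC, r, hr, hCr⟩
  refine ⟨(ε - r) / 2, by linarith, fun D hD hCD => ⟨hD, (r + ε) / 2, by linarith, fun x hx => ?_⟩⟩
  have hα : D x ∈ Ioc (0 : ℝ) 1 := ⟨hx, (hD.1.2 x).2⟩
  obtain ⟨y, hy, hyx⟩ := exists_mem_cut_dist_lt' hC hD hCD hα (y := x) (le_refl (D x))
  have := hCr y (hx.trans_le hy)
  have := dist_triangle_left x a y
  linarith

lemma isOpenIn_separated [CompactSpace X] (a b : X) {lo hi : ℝ} (hlo : lo ∈ Ioc (0 : ℝ) 1)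
    (hhi : hi ∈ Ioc (0 : ℝ) 1) (δ : ℝ) :
    IsOpenIn {A : X → ℝ | InF1 A} dInfty (separated a b lo hi δ) := by
  refine ⟨fun C hC => hC.1, ?_⟩
  rintro C ⟨hC, r, hr, ⟨q, hq, hqb⟩, hCr⟩
  refine ⟨(δ - r) / 2, by linarith, fun D hD hCD => ⟨hD, (r + δ) / 2, by linarith, ?_, ?_⟩⟩
  · obtain ⟨p, hp, hqp⟩ := exists_mem_cut_dist_lt hC hD hCD hlo hq
    have := dist_triangle_left p b q
    exact ⟨p, hp, by linarith⟩
  · intro x hx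
    obtain ⟨y, hy, hyx⟩ := exists_mem_cut_dist_lt' hC hD hCD hhi hx
    have := hCr y hy
    have := dist_triangle_left x a y
    linarith

lemma exists_inF1_two_points {a b : X} (hab : a ≠ b) {c : ℝ} (hc : c ∈ I01) :
    ∃ A : X → ℝ, InF1 A ∧ A a = 1 ∧ A b = c ∧ ∀ x, x ≠ a → x ≠ b → A x = 0 := by
  classical
  set A : X → ℝ := fun x => if x = a then 1 else if x = b then c else 0 with hAdef
  have hAa : A a = 1 := by simp [hAdef]
  have hAb : A b = c := by simp [hAdef, hab.symm]
  have hA0 : ∀ x, x ≠ a → x ≠ b → A x = 0 := fun x h1 h2 => by simp [hAdef, h1, h2]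
  have hAI : ∀ x, A x ∈ I01 := fun x => by
    by_cases h1 : x = a
    · rw [h1, hAa]; exact ⟨zero_le_one, le_rfl⟩
    by_cases h2 : x = b
    · rwa [h2, hAb]
    rw [hA0 x h1 h2]; exact ⟨le_rfl, zero_le_one⟩
  refine ⟨A, ⟨⟨upperSemicontinuous_iff_isClosed_preimage.2 fun α => ?_, hAI⟩, a, hAa.ge⟩,
    hAa, hAb, hA0⟩
  rcases le_or_gt α 0 with h0 | h0
  · convert isClosed_univ
    exact eq_univ_of_forall fun x => h0.trans (hAI x).1
  · refine (Set.Finite.subset (Set.toFinite {a, b}) fun x hx => ?_).isClosed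
    by_contra hx'
    simp only [mem_insert_iff, mem_singleton_iff, not_or] at hx'
    have : α ≤ A x := hx
    rw [hA0 x hx'.1 hx'.2] at this
    linarith

lemma concentrated_nonempty {a b : X} (hab : a ≠ b) {ε : ℝ} (hε : 0 < ε) :
    (concentrated a ε).Nonempty := by
  obtain ⟨A, hA, -, hAb, hA0⟩ := exists_inF1_two_points hab (c := 0) ⟨le_rfl, zero_le_one⟩
  refine ⟨A, hA, 0, hε, fun x hx => ?_⟩
  by_cases h1 : x = a
  · simp [h1]
  by_cases h2 : x = b
  · simp [h2, hAb] at hx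
  · simp [hA0 x h1 h2] at hx

lemma separated_nonempty {a b : X} (hab : a ≠ b) {lo hi δ : ℝ} (hlo : 0 < lo) (hlt : lo < hi)
    (hhi : hi ≤ 1) (hδ : 0 < δ) : (separated a b lo hi δ).Nonempty := by
  obtain ⟨A, hA, -, hAb, hA0⟩ :=
    exists_inF1_two_points hab (c := lo) ⟨hlo.le, hlt.le.trans hhi⟩
  refine ⟨A, hA, 0, hδ, ⟨b, hAb.ge, by simp⟩, fun x hx => ?_⟩
  have hx : hi ≤ A x := hx
  by_cases h1 : x = a
  · simp [h1]
  by_cases h2 : x = b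
  · rw [h2, hAb] at hx; linarith
  · rw [hA0 x h1 h2] at hx; linarith

end LevelwiseMetric

/-- If two levels `lo < hi` eventually merge under `ξ_g`, the `g`-fuzzification is not
transitive. -/
lemma not_transitiveOn_fuzz_of_iterate_eq {X : Type*} [MetricSpace X] [CompactSpace X]
    {a b : X} (hab : a ≠ b) {g : ℝ → ℝ} (hg : Dm g) {lo hi : ℝ} (hlo : 0 < lo) (hlt : lo < hi)
    (hhi : hi ≤ 1) {m : ℕ} (hmerge : ∀ n, m ≤ n → (xiG g)^[n] lo = (xiG g)^[n] hi)
    {f : X → X} (hf : Continuous f) :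
    ¬ TransitiveOn {A : X → ℝ | InF1 A} dInfty (fuzz f g) := by
  intro htrans
  have hd : 0 < dist a b := dist_pos.2 hab
  have hloI : lo ∈ Ioc (0 : ℝ) 1 := ⟨hlo, hlt.le.trans hhi⟩
  have hhiI : hi ∈ Ioc (0 : ℝ) 1 := ⟨hlo.trans hlt, hhi⟩
  have hnhds : ∀ᶠ x in nhds a, ∀ n ∈ Finset.range m,
      dist (f^[n] x) (f^[n] a) < dist a b / 4 :=
    (Finset.eventually_all _).2 fun n _ =>
      (hf.iterate n).continuousAt.eventually (ball_mem_nhds _ (by positivity))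
  obtain ⟨ε, hε, hball⟩ := Metric.eventually_nhds_iff.1 hnhds
  obtain ⟨n, _, ⟨C, ⟨hC, r, hr, hCr⟩, rfl⟩, hTC, s, hs, ⟨q, hq, hqb⟩, hTCs⟩ :=
    htrans _ _ (isOpenIn_concentrated a ε) (concentrated_nonempty hab hε)
      (isOpenIn_separated a b hloI hhiI (dist a b / 4))
      (separated_nonempty hab hlo hlt hhi (by positivity))
  rcases lt_or_ge n m with hn | hn
  · have key : ∀ α ∈ Ioc (0 : ℝ) 1, ∀ x ∈ cut ((fuzz f g)^[n] C) α,
        dist x (f^[n] a) < dist a b / 4 := by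
      intro α hα x hx
      rw [cut_iterate_fuzz hf hg n hC.1 hα] at hx
      obtain ⟨y, hy, rfl⟩ := hx
      exact hball ((hCr y ((xiG_iterate_mem_Ioc hg hα n).1.trans_le hy)).trans_lt hr) n
        (Finset.mem_range.2 hn)
    obtain ⟨p, hp⟩ := cut_nonempty hTC hhi
    have h1 := key _ hloI q hq
    have h2 := key _ hhiI p hp
    have h3 := hTCs p hp
    have h4 := dist_triangle4 a p q b
    rw [dist_comm a p] at h4
    have h5 := dist_triangle_right p q (f^[n] a)
    linarith
  · rw [cut_iterate_fuzz hf hg n hC.1 hloI, hmerge n hn,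
      ← cut_iterate_fuzz hf hg n hC.1 hhiI] at hq
    have h1 := hTCs q hq
    have h2 := dist_triangle_left a b q
    linarith

/-- If `X` is a nontrivial compact metric space and `g ∈ D_m(I)`
admits `z ∈ (0,1]` and `m ∈ ℕ` with `ξ_g z ≠ z` and `ξ_g^{m+1} z = ξ_g^m z`,
then for every continuous `f : X → X` the `g`-fuzzification is not transitive
on `(F^1(X), d_∞)`. -/
theorem stmt17 {X : Type*} [MetricSpace X] [CompactSpace X]
    (hX : ∃ a b : X, a ≠ b)
    (g : ℝ → ℝ) (hg : Dm g)
    (z : ℝ) (hz : z ∈ Set.Ioc (0:ℝ) 1) (m : ℕ) (hm : 1 ≤ m)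
    (hz1 : xiG g z ≠ z) (hz2 : (xiG g)^[m + 1] z = (xiG g)^[m] z)
    (f : X → X) (hf : Continuous f) :
    ¬ TransitiveOn {A : X → ℝ | InF1 A} dInfty (fuzz f g) := by
  obtain ⟨a, b, hab⟩ := hX
  set w := (xiG g)^[m] z with hw
  have hwI : w ∈ Ioc (0 : ℝ) 1 := xiG_iterate_mem_Ioc hg hz m
  have hfix : Function.IsFixedPt (xiG g) w := by
    rw [Function.iterate_succ_apply'] at hz2
    exact hz2
  have hmerge : ∀ n, m ≤ n → (xiG g)^[n] z = (xiG g)^[n] w := by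
    intro n hn
    obtain ⟨k, rfl⟩ := Nat.exists_eq_add_of_le' hn
    rw [(hfix.iterate _).eq, Function.iterate_add_apply, ← hw, (hfix.iterate _).eq]
  have hzw : z ≠ w := fun h => hz1 (by rw [h]; exact hfix)
  rcases hzw.lt_or_gt with h | h
  · exact not_transitiveOn_fuzz_of_iterate_eq hab hg hz.1 h hwI.2 hmerge hf
  · exact not_transitiveOn_fuzz_of_iterate_eq hab hg hwI.1 h hz.2
      (fun n hn => (hmerge n hn).symm) hf
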